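/- Let $j \in \mathbb{N}$, let $q \in (0,1)$ be a real number, and let $\alpha, x, y, z \in \mathbb{R}$ be such that none of the real numbers $\alpha-y-j+1+i$, $\alpha-x-j+1+i$, $y+i$, $x+i$ (for $i = 0,1,\dots,j-1$) equals $0$. Then $$\sum_{u=0}^{j} \frac{(q^{-j};q)_u\,(q^{\alpha};q)_u\,(q^{\alpha+z};q)_u}{(q;q)_u\,(q^{\alpha-y-j+1};q)_u\,(q^{\alpha-x-j+1};q)_u}\, q^u = \frac{(q^{-y-j+1};q)_j\,(q^{-x-j+1};q)_j\, q^{j\alpha}}{(q^{\alpha-y-j+1};q)_j\,(q^{\alpha-x-j+1};q)_j} \sum_{u=0}^{j} \frac{(q^{-j};q)_u\,(q^{\alpha};q)_u\,(q^{x+y+z+j-1};q)_u}{(q;q)_u\,(q^{y};q)_u\,(q^{x};q)_u}\, q^u.$$ (This is the intermediate transformation, equation (3.8) of the paper, obtained as the first step in the proof of the ${}_3\phi_2$-transformation lemma.) -/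

import Mathlib

/-- The `q`-Pochhammer symbol `(a; q)_n = ∏_{i=0}^{n-1} (1 - a qⁱ)`. -/
noncomputable def qPoch (a q : ℝ) (n : ℕ) : ℝ :=
  ∏ i ∈ Finset.range n, (1 - a * q ^ i)

lemma qP_succ (a q : ℝ) (n : ℕ) : qPoch a q (n+1) = qPoch a q n * (1 - a * q ^ n) := by
  simp [qPoch, Finset.prod_range_succ]

lemma qP_succ' (a q : ℝ) (n : ℕ) : qPoch a q (n+1) = (1 - a) * qPoch (a * q) q n := by
  simp only [qPoch, Finset.prod_range_succ']
  rw [mul_comm]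
  congr 1
  · simp
  · refine Finset.prod_congr rfl fun i _ => ?_
    ring

lemma qP_zero (a q : ℝ) : qPoch a q 0 = 1 := by simp [qPoch]

lemma qP_add (a q : ℝ) (m n : ℕ) :
    qPoch a q (m + n) = qPoch a q m * qPoch (a * q ^ m) q n := by
  simp only [qPoch, Finset.prod_range_add]
  congr 1
  refine Finset.prod_congr rfl fun i _ => ?_
  ring

lemma qP_split (a q : ℝ) {m n : ℕ} (h : m ≤ n) :
    qPoch a q n = qPoch a q m * qPoch (a * q ^ m) q (n - m) := by
  rw [← qP_add, Nat.add_sub_cancel' h]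

lemma qP_q_ne {q : ℝ} (h0 : 0 < q) (h1 : q < 1) (n : ℕ) : qPoch q q n ≠ 0 := by
  unfold qPoch
  refine Finset.prod_ne_zero_iff.2 fun i _ => ?_
  have : q ^ (i+1) < 1 := pow_lt_one₀ h0.le h1 (by omega)
  rw [pow_succ'] at this
  linarith

lemma choose_two_succ (n : ℕ) : (n+1).choose 2 = n + n.choose 2 := by
  rw [Nat.choose_succ_succ' n 1]; simp

lemma choose_two_add (m n : ℕ) : (m+n).choose 2 = m.choose 2 + n.choose 2 + m * n := by
  induction n with
  | zero => simp
  | succ n ih => rw [← add_assoc, choose_two_succ, ih, choose_two_succ]; ring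

/-- reversal -/
lemma qP_rev (q : ℝ) (n : ℕ) : ∀ c d : ℝ, c * d * q ^ n = q → q ≠ 0 →
    qPoch c q n = (-c) ^ n * q ^ (n.choose 2) * qPoch d q n := by
  induction n with
  | zero => intros; simp [qP_zero]
  | succ n ih =>
    intro c d h hq
    have h' : c * d * q ^ n = 1 := by
      apply mul_right_cancel₀ hq
      rw [pow_succ] at h; linarith
    rw [qP_succ', ih (c * q) d (by linear_combination h) hq, qP_succ, choose_two_succ, pow_add]
    have e : (1 - c) = -c * (1 - d * q ^ n) := by linear_combination (-1) * h'
    rw [e]; ring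

noncomputable def gauss (q : ℝ) (n k : ℕ) : ℝ :=
  if k ≤ n then qPoch q q n / (qPoch q q k * qPoch q q (n - k)) else 0

lemma gauss_add (q : ℝ) (k l : ℕ) :
    gauss q (k + l) k = qPoch q q (k+l) / (qPoch q q k * qPoch q q l) := by
  simp [gauss]

lemma gauss_gt (q : ℝ) {n k : ℕ} (h : n < k) : gauss q n k = 0 := by
  simp [gauss, h]

lemma gauss_zero {q : ℝ} (h0 : 0 < q) (h1 : q < 1) (n : ℕ) : gauss q n 0 = 1 := by
  have := qP_q_ne h0 h1 n
  simp [gauss, qP_zero, this]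

lemma gauss_self {q : ℝ} (h0 : 0 < q) (h1 : q < 1) (n : ℕ) : gauss q n n = 1 := by
  have := qP_q_ne h0 h1 n
  simp [gauss, qP_zero, this]

lemma gauss_pascal1 {q : ℝ} (h0 : 0 < q) (h1 : q < 1) {n k : ℕ} (h : k ≤ n) :
    gauss q (n+1) (k+1) = gauss q n (k+1) + q ^ (n - k) * gauss q n k := by
  obtain ⟨l, rfl⟩ := Nat.exists_eq_add_of_le h
  rw [Nat.add_sub_cancel_left]
  cases l with
  | zero => simp [gauss_self h0 h1, gauss_gt]
  | succ l =>
    rw [show k + (l+1) + 1 = (k+1) + (l+1) by ring, gauss_add, gauss_add,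
      show k + (l+1) = (k+1) + l by ring, gauss_add, ← add_assoc, qP_succ _ _ (k+1+l),
      qP_succ _ _ k, qP_succ _ _ l]
    have a1 := qP_q_ne h0 h1 k
    have a2 := qP_q_ne h0 h1 l
    have a3 := qP_q_ne h0 h1 (k+1)
    have a4 := qP_q_ne h0 h1 (l+1)
    rw [qP_succ] at a3 a4
    have a5 := right_ne_zero_of_mul a3
    have a6 := right_ne_zero_of_mul a4
    field_simp
    ring

lemma gauss_pascal2 {q : ℝ} (h0 : 0 < q) (h1 : q < 1) {n k : ℕ} (h : k ≤ n) :
    gauss q (n+1) (k+1) = q ^ (k+1) * gauss q n (k+1) + gauss q n k := by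
  obtain ⟨l, rfl⟩ := Nat.exists_eq_add_of_le h
  cases l with
  | zero => simp [gauss_self h0 h1, gauss_gt]
  | succ l =>
    rw [show k + (l+1) + 1 = (k+1) + (l+1) by ring, gauss_add, gauss_add,
      show k + (l+1) = (k+1) + l by ring, gauss_add, ← add_assoc, qP_succ _ _ (k+1+l),
      qP_succ _ _ k, qP_succ _ _ l]
    have a1 := qP_q_ne h0 h1 k
    have a2 := qP_q_ne h0 h1 l
    have a3 := qP_q_ne h0 h1 (k+1)
    have a4 := qP_q_ne h0 h1 (l+1)
    rw [qP_succ] at a3 a4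
    have a5 := right_ne_zero_of_mul a3
    have a6 := right_ne_zero_of_mul a4
    field_simp
    ring

lemma gauss_sum1 {q : ℝ} (h0 : 0 < q) (h1 : q < 1) (n : ℕ) (f : ℕ → ℝ) :
    ∑ k ∈ Finset.range (n+2), gauss q (n+1) k * f k =
      ∑ k ∈ Finset.range (n+1), gauss q n k * f k +
      ∑ k ∈ Finset.range (n+1), gauss q n k * (q ^ (n-k) * f (k+1)) := by
  have e : ∑ k ∈ Finset.range (n+1), gauss q n k * f k
      = ∑ k ∈ Finset.range (n+2), gauss q n k * f k := by
    rw [Finset.sum_range_succ _ (n+1), gauss_gt q (Nat.lt_succ_self n)]; simp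
  rw [e, Finset.sum_range_succ', Finset.sum_range_succ' _ (n+1), gauss_zero h0 h1,
    gauss_zero h0 h1, add_right_comm, ← Finset.sum_add_distrib]
  congr 1
  refine Finset.sum_congr rfl fun k hk => ?_
  rw [gauss_pascal1 h0 h1 (Nat.lt_succ_iff.1 (Finset.mem_range.1 hk))]
  ring

lemma gauss_sum2 {q : ℝ} (h0 : 0 < q) (h1 : q < 1) (n : ℕ) (f : ℕ → ℝ) :
    ∑ k ∈ Finset.range (n+2), gauss q (n+1) k * f k =
      ∑ k ∈ Finset.range (n+1), gauss q n k * (q ^ k * f k) +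
      ∑ k ∈ Finset.range (n+1), gauss q n k * f (k+1) := by
  have e : ∑ k ∈ Finset.range (n+1), gauss q n k * (q ^ k * f k)
      = ∑ k ∈ Finset.range (n+2), gauss q n k * (q ^ k * f k) := by
    rw [Finset.sum_range_succ _ (n+1), gauss_gt q (Nat.lt_succ_self n)]; simp
  rw [e, Finset.sum_range_succ', Finset.sum_range_succ' _ (n+1), gauss_zero h0 h1,
    gauss_zero h0 h1, add_right_comm, ← Finset.sum_add_distrib]
  congr 1
  · refine Finset.sum_congr rfl fun k hk => ?_
    rw [gauss_pascal2 h0 h1 (Nat.lt_succ_iff.1 (Finset.mem_range.1 hk))]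
    ring
  · simp

/-- q-Vandermonde, second form -/
lemma vander2 {q : ℝ} (h0 : 0 < q) (h1 : q < 1) (t : ℝ) (n : ℕ) : ∀ b : ℝ,
    ∑ k ∈ Finset.range (n+1), gauss q n k *
      ((-t) ^ k * q ^ (k.choose 2) * qPoch b q k * qPoch (t * b * q ^ k) q (n - k)) =
    qPoch t q n := by
  induction n with
  | zero => intro b; simp [gauss_zero h0 h1, qP_zero]
  | succ n ih =>
    intro b
    rw [gauss_sum1 h0 h1, qP_succ]
    have e1 : qPoch t q n * (1 - t * q ^ n) =
      (1 - t * b * q ^ n) * qPoch t q n + (-t * q ^ n * (1 - b)) * qPoch t q n := by ring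
    rw [e1]
    nth_rewrite 1 [← ih b]
    rw [← ih (b * q), Finset.mul_sum, Finset.mul_sum]
    congr 1
    · refine Finset.sum_congr rfl fun k hk => ?_
      obtain ⟨l, rfl⟩ := Nat.exists_eq_add_of_le (Nat.lt_succ_iff.1 (Finset.mem_range.1 hk))
      rw [Nat.add_sub_cancel_left, add_assoc, Nat.add_sub_cancel_left, qP_succ _ _ l]
      ring
    · refine Finset.sum_congr rfl fun k hk => ?_
      obtain ⟨l, rfl⟩ := Nat.exists_eq_add_of_le (Nat.lt_succ_iff.1 (Finset.mem_range.1 hk))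
      rw [Nat.add_sub_cancel_left, Nat.add_sub_add_right, Nat.add_sub_cancel_left, qP_succ' _ _ k,
        choose_two_succ, show t * b * q ^ (k+1) = t * (b * q) * q ^ k by ring]
      ring

/-- q-Vandermonde, first form -/
lemma vander1 {q : ℝ} (h0 : 0 < q) (h1 : q < 1) (t : ℝ) (n : ℕ) : ∀ b : ℝ,
    ∑ k ∈ Finset.range (n+1), gauss q n k *
      ((-1) ^ k * q ^ ((n-k).choose 2) * qPoch b q k * qPoch (b * t * q ^ k) q (n - k)) =
    q ^ (n.choose 2) * qPoch t q n * b ^ n := by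
  induction n with
  | zero => intro b; simp [gauss_zero h0 h1, qP_zero]
  | succ n ih =>
    intro b
    rw [gauss_sum2 h0 h1, qP_succ, choose_two_succ]
    have e1 : q ^ (n + n.choose 2) * (qPoch t q n * (1 - t * q ^ n)) * b ^ (n+1) =
      (q ^ n * (1 - b * t * q ^ n)) * (q ^ (n.choose 2) * qPoch t q n * b ^ n) +
      (-(1 - b)) * (q ^ (n.choose 2) * qPoch t q n * (b * q) ^ n) := by
      rw [mul_pow]; ring
    rw [e1, ← ih b, ← ih (b * q), Finset.mul_sum, Finset.mul_sum]
    congr 1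
    · refine Finset.sum_congr rfl fun k hk => ?_
      obtain ⟨l, rfl⟩ := Nat.exists_eq_add_of_le (Nat.lt_succ_iff.1 (Finset.mem_range.1 hk))
      rw [Nat.add_sub_cancel_left, add_assoc, Nat.add_sub_cancel_left, qP_succ _ _ l,
        choose_two_succ]
      ring
    · refine Finset.sum_congr rfl fun k hk => ?_
      obtain ⟨l, rfl⟩ := Nat.exists_eq_add_of_le (Nat.lt_succ_iff.1 (Finset.mem_range.1 hk))
      rw [Nat.add_sub_cancel_left, Nat.add_sub_add_right, Nat.add_sub_cancel_left, qP_succ' _ _ k,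
        show b * t * q ^ (k+1) = (b * q) * t * q ^ k by ring]
      ring

lemma gauss_mul {q : ℝ} (h0 : 0 < q) (h1 : q < 1) (m l r : ℕ) :
    gauss q (m + l + r) (m + l) * gauss q (m + l) m
      = gauss q (m + (l + r)) m * gauss q (l + r) l := by
  simp only [gauss_add]
  have a1 := qP_q_ne h0 h1 m
  have a2 := qP_q_ne h0 h1 l
  have a3 := qP_q_ne h0 h1 r
  have a4 := qP_q_ne h0 h1 (m+l)
  have a5 := qP_q_ne h0 h1 (l+r)
  rw [add_assoc]
  field_simp

lemma key {q : ℝ} (h0 : 0 < q) (h1 : q < 1) (N : ℕ) (a w b e : ℝ) :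
    ∑ u ∈ Finset.range (N+1), gauss q N u * ((-1) ^ u * q ^ ((N-u).choose 2) *
      qPoch a q u * qPoch w q u * qPoch (w * b * q ^ u) q (N-u) *
      qPoch (a * e * q ^ u) q (N-u)) =
    q ^ (N.choose 2) * ∑ m ∈ Finset.range (N+1), gauss q N m * (w ^ m * a ^ (N-m) *
      qPoch a q m * qPoch b q m * qPoch (w * b * q ^ m) q (N-m) * qPoch e q (N-m)) := by
  have s1 : ∀ u ∈ Finset.range (N+1), gauss q N u * ((-1) ^ u * q ^ ((N-u).choose 2) *
      qPoch a q u * qPoch w q u * qPoch (w * b * q ^ u) q (N-u) *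
      qPoch (a * e * q ^ u) q (N-u)) =
      ∑ m ∈ Finset.range (u+1), gauss q N u * ((-1) ^ u * q ^ ((N-u).choose 2) *
      qPoch a q u * qPoch (w * b * q ^ u) q (N-u) *
      qPoch (a * e * q ^ u) q (N-u)) * (gauss q u m * ((-w) ^ m * q ^ (m.choose 2) *
        qPoch b q m * qPoch (w * b * q ^ m) q (u-m))) := by
    intro u _
    rw [← Finset.mul_sum, vander2 h0 h1]
    ring
  rw [Finset.sum_congr rfl s1, Finset.mul_sum]
  have s2 : ∀ m ∈ Finset.range (N+1), q ^ (N.choose 2) * (gauss q N m * (w ^ m * a ^ (N-m) *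
      qPoch a q m * qPoch b q m * qPoch (w * b * q ^ m) q (N-m) * qPoch e q (N-m))) =
      ∑ l ∈ Finset.range (N - m + 1), gauss q N m * (w ^ m * q ^ (m.choose 2) *
       qPoch a q m * qPoch b q m * qPoch (w * b * q ^ m) q (N-m)) *
       (gauss q (N-m) l * ((-1) ^ l * q ^ ((N-m-l).choose 2) * qPoch (a * q ^ m) q l
         * qPoch (a * q ^ m * e * q ^ l) q (N - m - l))) := by
    intro m hm
    rw [← Finset.mul_sum, vander1 h0 h1]
    obtain ⟨l, rfl⟩ := Nat.exists_eq_add_of_le (Nat.lt_succ_iff.1 (Finset.mem_range.1 hm))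
    rw [Nat.add_sub_cancel_left, choose_two_add]
    ring
  rw [Finset.sum_congr rfl s2, Finset.sum_sigma', Finset.sum_sigma']
  refine Finset.sum_bij' (fun p _ => ⟨p.2, p.1 - p.2⟩) (fun p _ => ⟨p.1 + p.2, p.1⟩) ?_ ?_ ?_ ?_ ?_
  · rintro ⟨u, m⟩ h
    simp only [Finset.mem_sigma, Finset.mem_range] at h ⊢
    omega
  · rintro ⟨m, l⟩ h
    simp only [Finset.mem_sigma, Finset.mem_range] at h ⊢
    omega
  · rintro ⟨u, m⟩ h
    simp only [Finset.mem_sigma, Finset.mem_range] at h ⊢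
    simp; omega
  · rintro ⟨m, l⟩ h
    simp
  · rintro ⟨u, m⟩ h
    simp only [Finset.mem_sigma, Finset.mem_range] at h ⊢
    obtain ⟨l, rfl⟩ := Nat.exists_eq_add_of_le (Nat.lt_succ_iff.1 h.2)
    obtain ⟨r, rfl⟩ := Nat.exists_eq_add_of_le (Nat.lt_succ_iff.1 h.1)
    have g := gauss_mul h0 h1 m l r
    have e1 : m + l + r - m = l + r := by omega
    have e2 : m + l + r - (m + l) = r := by omega
    have e3 : m + l - m = l := by omega
    have e4 : l + r - l = r := by omega
    rw [e1, e2, e3, e4, qP_add a q m l, qP_add (w * b * q ^ m) q l r,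
      show a * q ^ m * e * q ^ l = a * e * q ^ (m + l) by ring,
      show w * b * q ^ m * q ^ l = w * b * q ^ (m + l) by ring]
    rw [show m + (l + r) = m + l + r by ring] at g
    have sg : (-1 : ℝ) ^ (m + l) * (-w) ^ m = (-1) ^ l * w ^ m := by
      rw [pow_add, neg_pow w m]
      have : (-1 : ℝ) ^ m * (-1) ^ m = 1 := by rw [← mul_pow]; simp
      linear_combination ((-1) ^ l * w ^ m) * this
    calc _ = (gauss q (m + l + r) (m + l) * gauss q (m + l) m) *
          ((-1 : ℝ) ^ (m + l) * (-w) ^ m) * (q ^ (r.choose 2) *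
          (qPoch a q m * qPoch (a * q ^ m) q l) * qPoch (w * b * q ^ (m + l)) q r *
          qPoch (a * e * q ^ (m + l)) q r * (q ^ (m.choose 2) * qPoch b q m *
          qPoch (w * b * q ^ m) q l)) := by ring
      _ = _ := by rw [g, sg]; ring

lemma qP_negN {q : ℝ} (n u : ℕ) : ∀ c : ℝ, c * q ^ (u + n) = 1 →
    qPoch c q u * qPoch q q n * q ^ u * q ^ ((u+n).choose 2)
      = (-1) ^ u * qPoch q q (u+n) * q ^ (n.choose 2) := by
  induction u with
  | zero => intros; simp [qP_zero]
  | succ u ih =>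
    intro c hc
    have h := ih (c * q) (by rw [← hc]; ring)
    rw [show u + 1 + n = (u + n) + 1 by ring] at *
    rw [qP_succ', choose_two_succ, qP_succ]
    have e : (1 - c) * q ^ (u + n + 1) = -(1 - q * q ^ (u+n)) := by
      rw [sub_mul, hc]; ring
    calc _ = ((1 - c) * q ^ (u+n+1)) * (qPoch (c * q) q u * qPoch q q n * q ^ u
          * q ^ ((u+n).choose 2)) := by ring
      _ = _ := by rw [e, h]; ring

/-- The `3φ2` sum in terms of the polynomial form. -/
lemma phi_poly {q : ℝ} (h0 : 0 < q) (h1 : q < 1) (N : ℕ) (c a w d e : ℝ)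
    (hc : c * q ^ N = 1) (hd : qPoch d q N ≠ 0) (he : qPoch e q N ≠ 0) :
    q ^ (N.choose 2) * (qPoch d q N * qPoch e q N) * ∑ u ∈ Finset.range (N+1),
      (qPoch c q u * qPoch a q u * qPoch w q u) / (qPoch q q u * qPoch d q u * qPoch e q u)
        * q ^ u = 
    ∑ u ∈ Finset.range (N+1), gauss q N u * ((-1) ^ u * q ^ ((N-u).choose 2) *
      qPoch a q u * qPoch w q u * qPoch (d * q ^ u) q (N-u) *
      qPoch (e * q ^ u) q (N-u)) := by
  rw [Finset.mul_sum]
  refine Finset.sum_congr rfl fun u hu => ?_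
  obtain ⟨n, rfl⟩ := Nat.exists_eq_add_of_le (Nat.lt_succ_iff.1 (Finset.mem_range.1 hu))
  rw [Nat.add_sub_cancel_left, gauss_add]
  have h := qP_negN n u c hc
  rw [qP_add] at hd he
  have d1 := left_ne_zero_of_mul hd
  have e1 := left_ne_zero_of_mul he
  rw [qP_add d, qP_add e]
  have a1 := qP_q_ne h0 h1 u
  have a2 := qP_q_ne h0 h1 n
  generalize qPoch (d * q ^ u) q n = dd
  generalize qPoch (e * q ^ u) q n = ee
  field_simp
  linear_combination (qPoch w q u * qPoch a q u * dd * ee) * h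

lemma core {q : ℝ} (h0 : 0 < q) (h1 : q < 1) (N : ℕ) (c p A X Y Z : ℝ) (p0 : p ≠ 0) (A0 : A ≠ 0)
    (X0 : X ≠ 0) (Y0 : Y ≠ 0) (Z0 : Z ≠ 0) (hc : c * q ^ N = 1) (hp : p * q ^ N = q)
    (d1 : qPoch (A * p / Y) q N ≠ 0) (d2 : qPoch (A * p / X) q N ≠ 0)
    (d3 : qPoch Y q N ≠ 0) (d4 : qPoch X q N ≠ 0) :
    ∑ u ∈ Finset.range (N + 1),
      (qPoch c q u * qPoch A q u * qPoch (A * Z) q u) /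
        (qPoch q q u * qPoch (A * p / Y) q u * qPoch (A * p / X) q u) * q ^ u
    = (qPoch (p / Y) q N * qPoch (p / X) q N * A ^ N) /
        (qPoch (A * p / Y) q N * qPoch (A * p / X) q N) *
      ∑ u ∈ Finset.range (N + 1),
        (qPoch c q u * qPoch A q u * qPoch (X * Y * Z / p) q u) /
          (qPoch q q u * qPoch Y q u * qPoch X q u) * q ^ u := by
  have hq := h0.ne'
  have r1 := phi_poly h0 h1 N c A (A * Z) (A * p / Y) (A * p / X) hc d1 d2
  have r2 := phi_poly h0 h1 N c A (X * Y * Z / p) X Y hc d4 d3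
  have k1 := key h0 h1 N A (A * Z) (p / (Y * Z)) (p / X)
  have k2 := key h0 h1 N A (X * Y * Z / p) (p / (Y * Z)) (Y / A)
  rw [show A * Z * (p / (Y * Z)) = A * p / Y by field_simp, ← mul_div_assoc, ← r1, mul_assoc] at k1
  rw [show X * Y * Z / p * (p / (Y * Z)) = X by field_simp, mul_div_cancel₀ _ A0, ← r2,
    mul_assoc] at k2
  have k1 := mul_left_cancel₀ (pow_ne_zero _ hq) k1
  have k2 := mul_left_cancel₀ (pow_ne_zero _ hq) k2
  have v1 := qP_rev q N Y (p / Y) (by rw [mul_div_cancel₀ _ Y0, hp]) hq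
  have v2 := qP_rev q N X (p / X) (by rw [mul_div_cancel₀ _ X0, hp]) hq
  have comm : ∀ u, qPoch q q u * qPoch X q u * qPoch Y q u
      = qPoch q q u * qPoch Y q u * qPoch X q u := fun u => by ring
  simp only [comm] at k2
  have M : (X * Y) ^ N * (q ^ (N.choose 2)) ^ 2 *
      ∑ m ∈ Finset.range (N+1), gauss q N m * ((A * Z) ^ m * A ^ (N-m) *
      qPoch A q m * qPoch (p / (Y * Z)) q m * qPoch (A * p / Y * q ^ m) q (N-m) *
        qPoch (p / X) q (N-m)) = A ^ N *
      ∑ m ∈ Finset.range (N+1), gauss q N m * ((X * Y * Z / p) ^ m * A ^ (N-m) *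
      qPoch A q m * qPoch (p / (Y * Z)) q m * qPoch (X * q ^ m) q (N-m) *
        qPoch (Y / A) q (N-m)) := by
    rw [Finset.mul_sum, Finset.mul_sum]
    refine Finset.sum_congr rfl fun m hm => ?_
    obtain ⟨n, rfl⟩ := Nat.exists_eq_add_of_le (Nat.lt_succ_iff.1 (Finset.mem_range.1 hm))
    rw [Nat.add_sub_cancel_left]
    have w1 := qP_rev q n (Y / A) (A * p / Y * q ^ m) (by
      rw [pow_add] at hp
      have : Y / A * (A * p / Y * q ^ m) = p * q ^ m := by field_simp
      rw [this]; linear_combination hp) hq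
    have w2 := qP_rev q n (X * q ^ m) (p / X) (by
      rw [pow_add] at hp; field_simp; linear_combination hp) hq
    rw [w1, w2]
    have ex : (q ^ ((m+n).choose 2)) ^ 2 * p ^ m = q ^ (m * n) * (q ^ (n.choose 2)) ^ 2 := by
      apply mul_right_cancel₀ (pow_ne_zero m hq)
      have c2 : m.choose 2 * 2 + m = m * m := by
        clear * -
        induction m with
        | zero => simp
        | succ m ih => rw [choose_two_succ]; linarith
      have hpm : p ^ m * q ^ ((m + n) * m) = q ^ m := by rw [pow_mul, ← mul_pow, hp]
      calc _ = (p ^ m * q ^ (m.choose 2 * 2 + m + m * n)) *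
            (q ^ (m * n) * (q ^ (n.choose 2)) ^ 2) := by rw [choose_two_add]; ring
        _ = _ := by
            rw [c2, show m * m + m * n = (m + n) * m by ring, hpm]; ring
    generalize qPoch (A * p / Y * q ^ m) q n = D1
    generalize qPoch (p / X) q n = D2
    generalize qPoch (p / (Y * Z)) q m = D3
    have sg : (-(Y / A)) ^ n * (-(X * q ^ m)) ^ n * A ^ n = (X * Y) ^ n * q ^ (m * n) := by
      rw [← mul_pow, ← mul_pow, pow_mul, ← mul_pow]; congr 1; field_simp
    have pm : p ^ m ≠ 0 := pow_ne_zero _ p0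
    have sz : (X * Y * Z / p) ^ m * p ^ m = (X * Y * Z) ^ m := by
      rw [← mul_pow]; congr 1; field_simp
    apply mul_right_cancel₀ pm
    calc _ = (X * Y) ^ (m+n) * ((q ^ ((m+n).choose 2)) ^ 2 * p ^ m) * (gauss q (m+n) m *
          ((A * Z) ^ m * A ^ n * qPoch A q m * D3 * D1 * D2)) := by ring
      _ = A ^ (m + n) * (gauss q (m+n) m * (((X * Y * Z / p) ^ m * p ^ m) * qPoch A q m * D3 *
          ((-(Y / A)) ^ n * (-(X * q ^ m)) ^ n * A ^ n) * (q ^ (n.choose 2)) ^ 2 * D1 * D2)) := by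
          rw [ex, sz, sg]; simp only [mul_pow]; ring
      _ = _ := by ring
  rw [← k1, ← k2, v1, v2] at M
  have sXY : (-X) ^ N * (-Y) ^ N = (X * Y) ^ N := by rw [← mul_pow]; congr 1; ring
  have hK : (X * Y) ^ N * (q ^ (N.choose 2)) ^ 2 ≠ 0 :=
    mul_ne_zero (pow_ne_zero _ (mul_ne_zero X0 Y0)) (pow_ne_zero _ (pow_ne_zero _ hq))
  rw [div_mul_eq_mul_div, eq_div_iff (mul_ne_zero d1 d2)]
  apply mul_left_cancel₀ hK
  rw [mul_comm (Finset.sum _ _) (qPoch (A * p / Y) q N * _), M, ← sXY]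
  ring

/-- The intermediate `₃φ₂` transformation (equation (3.8) of
Haglund–Rhoades–Shimozono), first step in the proof of their hypergeometric lemma. -/
theorem three_phi_two_intermediate_transformation
    (j : ℕ) (q α x y z : ℝ) (hq0 : 0 < q) (hq1 : q < 1)
    (h1 : ∀ i : ℕ, i < j → α - y - (j : ℝ) + 1 + i ≠ 0)
    (h2 : ∀ i : ℕ, i < j → α - x - (j : ℝ) + 1 + i ≠ 0)
    (h3 : ∀ i : ℕ, i < j → y + (i : ℝ) ≠ 0)
    (h4 : ∀ i : ℕ, i < j → x + (i : ℝ) ≠ 0) :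
    ∑ u ∈ Finset.range (j + 1),
      (qPoch (q ^ (-(j : ℝ))) q u * qPoch (q ^ α) q u * qPoch (q ^ (α + z)) q u) /
        (qPoch q q u * qPoch (q ^ (α - y - (j : ℝ) + 1)) q u *
          qPoch (q ^ (α - x - (j : ℝ) + 1)) q u) * q ^ (u : ℝ)
    = (qPoch (q ^ (-y - (j : ℝ) + 1)) q j * qPoch (q ^ (-x - (j : ℝ) + 1)) q j *
          q ^ ((j : ℝ) * α)) /
        (qPoch (q ^ (α - y - (j : ℝ) + 1)) q j * qPoch (q ^ (α - x - (j : ℝ) + 1)) q j) *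
      ∑ u ∈ Finset.range (j + 1),
        (qPoch (q ^ (-(j : ℝ))) q u * qPoch (q ^ α) q u *
            qPoch (q ^ (x + y + z + (j : ℝ) - 1)) q u) /
          (qPoch q q u * qPoch (q ^ y) q u * qPoch (q ^ x) q u) * q ^ (u : ℝ) := by
  have hp : ∀ t : ℝ, q ^ t ≠ 0 := fun t => (Real.rpow_pos_of_pos hq0 t).ne'
  have hne : ∀ t : ℝ, (∀ i : ℕ, i < j → t + (i : ℝ) ≠ 0) → qPoch (q ^ t) q j ≠ 0 := by
    intro t ht
    refine Finset.prod_ne_zero_iff.2 fun i hi => ?_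
    rw [← Real.rpow_natCast, ← Real.rpow_add hq0]
    intro h
    have h' : q ^ (t + (i : ℝ)) = 1 := by linarith
    have h'' := congrArg Real.log h'
    rw [Real.log_rpow hq0, Real.log_one] at h''
    rcases mul_eq_zero.1 h'' with h | h
    · exact ht i (Finset.mem_range.1 hi) h
    · exact (Real.log_neg hq0 hq1).ne h
  have d1 := hne _ h1
  have d2 := hne _ h2
  have d3 := hne _ h3
  have d4 := hne _ h4
  have E1 : q ^ (α - y - (j : ℝ) + 1) = q ^ α * q ^ (-(j : ℝ) + 1) / q ^ y := by
    rw [← Real.rpow_add hq0, ← Real.rpow_sub hq0]; congr 1; ring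
  have E2 : q ^ (α - x - (j : ℝ) + 1) = q ^ α * q ^ (-(j : ℝ) + 1) / q ^ x := by
    rw [← Real.rpow_add hq0, ← Real.rpow_sub hq0]; congr 1; ring
  have E3 : q ^ (-y - (j : ℝ) + 1) = q ^ (-(j : ℝ) + 1) / q ^ y := by
    rw [← Real.rpow_sub hq0]; congr 1; ring
  have E4 : q ^ (-x - (j : ℝ) + 1) = q ^ (-(j : ℝ) + 1) / q ^ x := by
    rw [← Real.rpow_sub hq0]; congr 1; ring
  have E5 : q ^ (x + y + z + (j : ℝ) - 1) = q ^ x * q ^ y * q ^ z / q ^ (-(j : ℝ) + 1) := by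
    rw [← Real.rpow_add hq0, ← Real.rpow_add hq0, ← Real.rpow_sub hq0]; congr 1; ring
  have E6 : q ^ ((j : ℝ) * α) = (q ^ α) ^ j := by
    rw [mul_comm, Real.rpow_mul hq0.le, Real.rpow_natCast]
  have E7 : q ^ (-(j : ℝ)) * q ^ j = 1 := by
    rw [← Real.rpow_natCast, ← Real.rpow_add hq0]; simp
  have E8 : q ^ (-(j : ℝ) + 1) * q ^ j = q := by
    rw [← Real.rpow_natCast, ← Real.rpow_add hq0]; simp
  have E9 : q ^ (α + z) = q ^ α * q ^ z := Real.rpow_add hq0 _ _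
  rw [E1] at d1
  rw [E2] at d2
  simp only [E1, E2, E3, E4, E5, E6, E9, Real.rpow_natCast]
  exact core hq0 hq1 j _ _ _ _ _ _ (hp _) (hp _) (hp _) (hp _) (hp _) E7 E8 d1 d2 d3 d4
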